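/- O(1/k) convergence of gradient descent on a smooth convex function: let f : ℝ^n → ℝ be convex and differentiable with L-Lipschitz gradient (L > 0), let 0 < α ≤ 1/L, let λ* be a global minimizer of f, and define iterates λ^{(i+1)} = λ^{(i)} − α∇f(λ^{(i)}) from an initial point λ^{(0)} ∈ ℝ^n. Then for every positive integer k, f(λ^{(k)}) − f(λ*) ≤ ‖λ^{(0)} − λ*‖² / (2αk). -/

import Mathlib

open scoped RealInnerProductSpace

section GradientDescent

variable {E : Type*} [NormedAddCommGroup E] [InnerProductSpace ℝ E] [CompleteSpace E]
  {f : E → ℝ} {f' : E → E}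

/-- The derivative of a function along a line, in terms of its gradient. -/
theorem HasGradientAt.hasDerivAt_comp_add_smul {g x v : E} {t : ℝ}
    (h : HasGradientAt f g (x + t • v)) :
    HasDerivAt (fun s : ℝ => f (x + s • v)) ⟪g, v⟫ t := by
  have hline : HasDerivAt (fun s : ℝ => x + s • v) v t := by
    simpa using ((hasDerivAt_id t).smul_const v).const_add x
  simpa [Function.comp_def] using h.hasFDerivAt.comp_hasDerivAt t hline

/-- A convex function lies above its tangent hyperplanes. -/
theorem ConvexOn.add_inner_sub_le_of_hasGradientAt {g x : E} (hconv : ConvexOn ℝ Set.univ f)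
    (h : HasGradientAt f g x) (y : E) : f x + ⟪g, y - x⟫ ≤ f y := by
  have hline : ConvexOn ℝ Set.univ (fun t : ℝ => f (x + t • (y - x))) := by
    simpa [Function.comp_def, AffineMap.lineMap_apply, add_comm] using
      hconv.comp_affineMap (AffineMap.lineMap x y : ℝ →ᵃ[ℝ] E)
  have hderiv : HasDerivAt (fun t : ℝ => f (x + t • (y - x))) ⟪g, y - x⟫ 0 :=
    HasGradientAt.hasDerivAt_comp_add_smul (by simpa using h)
  have hslope := hline.le_slope_of_hasDerivAt (Set.mem_univ 0) (Set.mem_univ 1) one_pos hderiv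
  simp [slope_def_field] at hslope
  linarith

/-- The descent lemma: a function with `L`-Lipschitz gradient lies below a quadratic. -/
theorem le_add_inner_add_sq_of_lipschitz_gradient (hdiff : ∀ x, HasGradientAt f (f' x) x) {L : ℝ}
    (hlip : ∀ x y, ‖f' x - f' y‖ ≤ L * ‖x - y‖) (x v : E) :
    f (x + v) ≤ f x + ⟪f' x, v⟫ + L / 2 * ‖v‖ ^ 2 := by
  have hderiv (t : ℝ) :
      HasDerivAt (fun s : ℝ => f (x + s • v) - s * ⟪f' x, v⟫ - s ^ 2 * (L / 2 * ‖v‖ ^ 2))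
        (⟪f' (x + t • v), v⟫ - ⟪f' x, v⟫ - 2 * t * (L / 2 * ‖v‖ ^ 2)) t := by
    have hlin := (hasDerivAt_id t).mul_const ⟪f' x, v⟫
    have hquad := (hasDerivAt_pow 2 t).mul_const (L / 2 * ‖v‖ ^ 2)
    simpa using ((hdiff _).hasDerivAt_comp_add_smul.fun_sub hlin).fun_sub hquad
  have hanti : AntitoneOn
      (fun s : ℝ => f (x + s • v) - s * ⟪f' x, v⟫ - s ^ 2 * (L / 2 * ‖v‖ ^ 2))
      (Set.Icc 0 1) := by
    refine antitoneOn_of_hasDerivWithinAt_nonpos (convex_Icc 0 1)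
      (fun t _ => (hderiv t).continuousAt.continuousWithinAt)
      (fun t _ => (hderiv t).hasDerivWithinAt) fun t ht => ?_
    rw [interior_Icc] at ht
    have hinner : ⟪f' (x + t • v) - f' x, v⟫ ≤ L * (t * ‖v‖) * ‖v‖ := by
      refine (real_inner_le_norm _ _).trans (mul_le_mul_of_nonneg_right ?_ (norm_nonneg v))
      simpa [norm_smul, abs_of_pos ht.1] using hlip (x + t • v) x
    rw [inner_sub_left] at hinner
    linarith
  have hle := hanti (Set.left_mem_Icc.2 zero_le_one) (Set.right_mem_Icc.2 zero_le_one) zero_le_one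
  simp at hle
  linarith

/-- One gradient descent step decreases the squared distance to any point `z` by at least `2 * α`
times the excess of the new function value over `f z`. -/
theorem two_mul_sub_le_of_gradient_step (hconv : ConvexOn ℝ Set.univ f)
    (hdiff : ∀ x, HasGradientAt f (f' x) x) {L : ℝ}
    (hlip : ∀ x y, ‖f' x - f' y‖ ≤ L * ‖x - y‖) {α : ℝ} (hα0 : 0 ≤ α) (hα : L * α ≤ 1) (x z : E) :
    2 * α * (f (x - α • f' x) - f z) ≤ ‖x - z‖ ^ 2 - ‖x - α • f' x - z‖ ^ 2 := by
  have hdescent := le_add_inner_add_sq_of_lipschitz_gradient hdiff hlip x (-(α • f' x))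
  have htangent := hconv.add_inner_sub_le_of_hasGradientAt (hdiff x) z
  have hexpand : ‖x - α • f' x - z‖ ^ 2 =
      ‖x - z‖ ^ 2 + 2 * α * ⟪f' x, z - x⟫ + α ^ 2 * ‖f' x‖ ^ 2 := by
    rw [sub_right_comm, norm_sub_sq_real, real_inner_smul_right, real_inner_comm,
      ← neg_sub z x, inner_neg_right, norm_smul, mul_pow, Real.norm_eq_abs, sq_abs]
    ring
  rw [← sub_eq_add_neg, inner_neg_right, real_inner_smul_right, real_inner_self_eq_norm_sq,
    norm_neg, norm_smul, mul_pow, Real.norm_eq_abs, sq_abs] at hdescent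
  have hstep : L * α * (α * ‖f' x‖ ^ 2) ≤ 1 * (α * ‖f' x‖ ^ 2) := by gcongr
  have hgap : f (x - α • f' x) - f z ≤ -⟪f' x, z - x⟫ - α / 2 * ‖f' x‖ ^ 2 := by linarith
  have hscaled := mul_le_mul_of_nonneg_left hgap (mul_nonneg zero_le_two hα0)
  rw [hexpand]
  linarith

end GradientDescent

/-- `O(1/k)` convergence of gradient descent on a smooth convex function. -/
theorem stmt_19 (n : ℕ) (hn : 0 < n)
    (f : EuclideanSpace ℝ (Fin n) → ℝ)
    (f' : EuclideanSpace ℝ (Fin n) → EuclideanSpace ℝ (Fin n))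
    (hconv : ConvexOn ℝ Set.univ f)
    (hdiff : ∀ x, HasGradientAt f (f' x) x)
    (L : ℝ) (hL : 0 < L)
    (hlip : ∀ x y, ‖f' x - f' y‖ ≤ L * ‖x - y‖)
    (α : ℝ) (hα0 : 0 < α) (hα : α ≤ 1 / L)
    (lstar : EuclideanSpace ℝ (Fin n)) (hmin : ∀ x, f lstar ≤ f x)
    (lam : ℕ → EuclideanSpace ℝ (Fin n))
    (hiter : ∀ i, lam (i + 1) = lam i - α • f' (lam i))
    (k : ℕ) (hk : 0 < k) :
    f (lam k) - f lstar ≤ ‖lam 0 - lstar‖ ^ 2 / (2 * α * k) := by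
  have hLα : L * α ≤ 1 := by rwa [le_div_iff₀' hL] at hα
  have hstep (i : ℕ) (z : EuclideanSpace ℝ (Fin n)) :
      2 * α * (f (lam (i + 1)) - f z) ≤ ‖lam i - z‖ ^ 2 - ‖lam (i + 1) - z‖ ^ 2 := by
    rw [hiter]
    exact two_mul_sub_le_of_gradient_step hconv hdiff hlip hα0.le hLα _ _
  have htele (m : ℕ) :
      2 * α * m * (f (lam m) - f lstar) ≤ ‖lam 0 - lstar‖ ^ 2 - ‖lam m - lstar‖ ^ 2 := by
    induction m with
    | zero => simp
    | succ m ih =>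
      have hmono : 2 * α * (f (lam (m + 1)) - f (lam m)) ≤ 0 := by
        refine (hstep m (lam m)).trans ?_
        simp
      have hmul := mul_nonpos_of_nonneg_of_nonpos (Nat.cast_nonneg (α := ℝ) m) hmono
      push_cast
      linarith [hstep m lstar]
  rw [le_div_iff₀' (by positivity)]
  exact (htele k).trans (sub_le_self _ (sq_nonneg _))
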